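/- arXiv:2407.06467 — 5 statements merged into one kernel-verified Lean document; each statement's English description precedes it below -/
import Mathlib

section
/- Let Ψ be a real n × d matrix, P a real n × l matrix, and P̂ a real d × l matrix, and form the (d+l) × (n+l) block matrix M := [[Ψᵀ, P̂], [Pᵀ, 0]]. Assume rank M = d + l (full row rank). Let b₁ : Fin d → ℝ and b₂ : Fin l → ℝ, and let w := Mᵀ *ᵥ ((M * Mᵀ)⁻¹ *ᵥ b) be the pseudoinverse solution, where b is the concatenation of b₁ and b₂. Writing w_A : Fin n → ℝ for the first n components of w, one has Pᵀ *ᵥ w_A = b₂. -/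
open Matrix

/-- A square matrix over a field whose rank equals its size is invertible. -/
theorem Matrix.isUnit_of_rank_eq_card {m K : Type*} [Fintype m] [DecidableEq m] [Field K]
    {A : Matrix m m K} (h : A.rank = Fintype.card m) : IsUnit A := by
  rw [← Matrix.mulVec_surjective_iff_isUnit]
  have hrange : LinearMap.range A.mulVecLin = ⊤ :=
    Submodule.eq_top_of_finrank_eq (by rw [Module.finrank_fintype_fun_eq_card]; exact h)
  exact LinearMap.range_eq_top.mp hrange

/-- For a real matrix of full row rank, `Mᵀ (M Mᵀ)⁻¹ b` solves `M w = b`. -/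
theorem Matrix.mulVec_transpose_mulVec_inv_of_rank_eq_card {m n : Type*} [Fintype m]
    [DecidableEq m] [Fintype n] {M : Matrix m n ℝ} (h : M.rank = Fintype.card m) (b : m → ℝ) :
    M *ᵥ (Mᵀ *ᵥ ((M * Mᵀ)⁻¹ *ᵥ b)) = b := by
  have hu : IsUnit (M * Mᵀ) :=
    Matrix.isUnit_of_rank_eq_card ((Matrix.rank_self_mul_transpose M).trans h)
  rw [Matrix.mulVec_mulVec, Matrix.mulVec_mulVec,
    Matrix.mul_nonsing_inv _ ((Matrix.isUnit_iff_isUnit_det _).mp hu), Matrix.one_mulVec]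

/-- Lemma 1 of the paper: for the full-row-rank block matrix
`M = [[Ψᵀ, P̂], [Pᵀ, 0]]`, the first `n` components `w_A` of the pseudoinverse
solution `w = Mᵀ (M Mᵀ)⁻¹ b` satisfy `Pᵀ w_A = b₂`. -/
theorem blockMatrix_pseudoinverse_weights (n d l : ℕ)
    (Ψ : Matrix (Fin n) (Fin d) ℝ) (P : Matrix (Fin n) (Fin l) ℝ)
    (Phat : Matrix (Fin d) (Fin l) ℝ)
    (M : Matrix (Fin d ⊕ Fin l) (Fin n ⊕ Fin l) ℝ)
    (hM : M = Matrix.fromBlocks Ψ.transpose Phat P.transpose 0)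
    (hrank : M.rank = d + l)
    (b₁ : Fin d → ℝ) (b₂ : Fin l → ℝ) (b : Fin d ⊕ Fin l → ℝ)
    (hb : b = Sum.elim b₁ b₂)
    (w : Fin n ⊕ Fin l → ℝ)
    (hw : w = M.transpose *ᵥ ((M * M.transpose)⁻¹ *ᵥ b))
    (wA : Fin n → ℝ) (hwA : wA = fun i => w (Sum.inl i)) :
    P.transpose *ᵥ wA = b₂ := by
  have h : M *ᵥ w = b := by
    rw [hw]
    exact Matrix.mulVec_transpose_mulVec_inv_of_rank_eq_card (by simpa using hrank) b
  subst hM hb hwA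
  rw [Matrix.fromBlocks_mulVec] at h
  have h₂ := congrArg (fun v => v ∘ Sum.inr) h
  simpa [Function.comp_def] using h₂
end

section
/- Fix D ≥ 1, a center x̂ ∈ EuclideanSpace ℝ (Fin D), a shape parameter c ∈ ℝ, and a twice continuously differentiable function f : ℝ → ℝ. Define h : EuclideanSpace ℝ (Fin D) → ℝ by h(x) = f(c‖x − x̂‖²). Then for every y, the Laplacian of h satisfies Δh(y) = 2cD·f'(c‖y − x̂‖²) + 4c²‖y − x̂‖²·f''(c‖y − x̂‖²). -/
/-- The Laplacian of `u : EuclideanSpace ℝ (Fin D) → ℝ` at `x`: the sum of the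
second partial derivatives of `u` in the coordinate directions. -/
noncomputable def laplacian {D : ℕ} (u : EuclideanSpace ℝ (Fin D) → ℝ)
    (x : EuclideanSpace ℝ (Fin D)) : ℝ :=
  ∑ p : Fin D,
    iteratedFDeriv ℝ 2 u x ![EuclideanSpace.single p (1 : ℝ), EuclideanSpace.single p (1 : ℝ)]

/-- The derivative of `x ↦ g (c * ‖x - a‖ ^ 2)` in a real inner product space. -/
theorem HasDerivAt.hasFDerivAt_comp_const_mul_norm_sub_sq {E : Type*} [NormedAddCommGroup E]
    [InnerProductSpace ℝ E] {g : ℝ → ℝ} {g' c : ℝ} {a x : E}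
    (hg : HasDerivAt g g' (c * ‖x - a‖ ^ 2)) :
    HasFDerivAt (fun z => g (c * ‖z - a‖ ^ 2)) ((2 * c * g') • innerSL ℝ (x - a)) x := by
  have hx : HasFDerivAt (fun z : E => z - a) (ContinuousLinearMap.id ℝ E) x :=
    (hasFDerivAt_id x).sub_const a
  refine (hg.comp_hasFDerivAt x (hx.norm_sq.const_mul c)).congr_fderiv ?_
  ext v
  simp
  ring

/-- The second derivative of `x ↦ f (c * ‖x - a‖ ^ 2)` in a real inner product space. -/
theorem iteratedFDeriv_two_comp_const_mul_norm_sub_sq {E : Type*} [NormedAddCommGroup E]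
    [InnerProductSpace ℝ E] {f : ℝ → ℝ} (hf : ContDiff ℝ 2 f) (c : ℝ) (a y v w : E) :
    iteratedFDeriv ℝ 2 (fun x => f (c * ‖x - a‖ ^ 2)) y ![v, w] =
      2 * c * deriv f (c * ‖y - a‖ ^ 2) * inner ℝ v w +
        4 * c ^ 2 * deriv (deriv f) (c * ‖y - a‖ ^ 2) *
          (inner ℝ (y - a) v * inner ℝ (y - a) w) := by
  have hf' : Differentiable ℝ f := hf.differentiable (by norm_num)
  have hf'' : Differentiable ℝ (deriv f) :=
    ((contDiff_succ_iff_deriv (n := 1)).1 hf).2.2.differentiable (by norm_num)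
  have hfderiv : fderiv ℝ (fun x => f (c * ‖x - a‖ ^ 2)) =
      fun x => (2 * c * deriv f (c * ‖x - a‖ ^ 2)) • innerSL ℝ (x - a) :=
    funext fun x => (hf' _).hasDerivAt.hasFDerivAt_comp_const_mul_norm_sub_sq.fderiv
  have hinner : HasFDerivAt (fun x : E => innerSL ℝ (x - a)) (innerSL ℝ : E →L[ℝ] E →L[ℝ] ℝ) y :=
    (innerSL ℝ : E →L[ℝ] E →L[ℝ] ℝ).hasFDerivAt.comp y ((hasFDerivAt_id y).sub_const a)
  have hcoeff := ((hf'' (c * ‖y - a‖ ^ 2)).hasDerivAt.hasFDerivAt_comp_const_mul_norm_sub_sq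
    ).const_mul (2 * c)
  rw [iteratedFDeriv_two_apply, hfderiv, (hcoeff.fun_smul hinner).fderiv]
  have hvw : (innerSL ℝ : E →L[ℝ] E →L[ℝ] ℝ) v w = inner ℝ v w := rfl
  simp [hvw, inner_sub_left]
  ring

/-- The Laplacian of the radial function `h(x) = f(c‖x − x̂‖²)`:
`Δh(y) = 2cD f'(c‖y − x̂‖²) + 4c²‖y − x̂‖² f''(c‖y − x̂‖²)`. -/
theorem laplacian_radial (D : ℕ) (hD : 1 ≤ D)
    (xhat : EuclideanSpace ℝ (Fin D)) (c : ℝ) (f : ℝ → ℝ) (hf : ContDiff ℝ 2 f)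
    (h : EuclideanSpace ℝ (Fin D) → ℝ)
    (hh : h = fun x => f (c * ‖x - xhat‖ ^ 2)) :
    ∀ y : EuclideanSpace ℝ (Fin D),
      laplacian h y =
        2 * c * D * deriv f (c * ‖y - xhat‖ ^ 2) +
          4 * c ^ 2 * ‖y - xhat‖ ^ 2 * deriv (deriv f) (c * ‖y - xhat‖ ^ 2) := by
  intro y
  subst hh
  have hnorm : ‖y - xhat‖ ^ 2 = ∑ p : Fin D, (y - xhat) p ^ 2 :=
    EuclideanSpace.real_norm_sq_eq (y - xhat)
  simp only [laplacian, iteratedFDeriv_two_comp_const_mul_norm_sub_sq hf,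
    EuclideanSpace.inner_single_right, Finset.sum_add_distrib, ← Finset.mul_sum]
  simp [← sq] at hnorm ⊢
  rw [← hnorm]
  ring
end

section
/- Fix D ≥ 1, a point x̂ ∈ EuclideanSpace ℝ (Fin D) with x̂ ≠ 0, a constant κ > 0, and a twice continuously differentiable f : ℝ → ℝ. For h > 0 set the shape parameter c := κ/h², and let ψ_h(x) := f(c‖x − h·x̂‖²) − f(c‖h·x̂‖²). Then the Laplacian of ψ_h at the origin equals h⁻² · A, where A := 2Dκ·f'(κ‖x̂‖²) + 4κ²‖x̂‖²·f''(κ‖x̂‖²) is independent of h. In particular |Δψ_h(0)| = O(h⁻²) as h → 0 when ch² is held constant. -/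
theorem hasFDerivAt_radial {E : Type*} [NormedAddCommGroup E] [InnerProductSpace ℝ E]
    {f : ℝ → ℝ} (hf : Differentiable ℝ f) (a : E) (c : ℝ) (x : E) :
    HasFDerivAt (fun y => f (c * ‖y - a‖ ^ 2))
      ((deriv f (c * ‖x - a‖ ^ 2) * (2 * c)) • innerSL ℝ (x - a)) x := by
  have h := (hf (c * ‖x - a‖ ^ 2)).hasDerivAt.comp_hasFDerivAt x
    ((((hasFDerivAt_id x).sub_const a).norm_sq).const_mul c)
  refine h.congr_fderiv ?_
  ext v
  simp
  ring

theorem iteratedFDeriv_two_radial_sub_const {E : Type*} [NormedAddCommGroup E]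
    [InnerProductSpace ℝ E] {f : ℝ → ℝ} (hf : ContDiff ℝ 2 f) (a : E) (c b : ℝ) (x v : E) :
    iteratedFDeriv ℝ 2 (fun y => f (c * ‖y - a‖ ^ 2) - b) x ![v, v] =
      deriv f (c * ‖x - a‖ ^ 2) * (2 * c) * ‖v‖ ^ 2 +
        deriv (deriv f) (c * ‖x - a‖ ^ 2) * (2 * c) ^ 2 * inner ℝ (x - a) v ^ 2 := by
  have hf₁ : Differentiable ℝ f := hf.differentiable (by norm_num)
  have hf₂ : Differentiable ℝ (deriv f) := by
    have hf' : ContDiff ℝ (1 + 1) f := by simpa [one_add_one_eq_two] using hf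
    exact (contDiff_succ_iff_deriv.1 hf').2.2.differentiable (by norm_num)
  let L : E →L[ℝ] E →L[ℝ] ℝ := innerSL ℝ
  have hL (y z : E) : L y z = inner ℝ y z := rfl
  have hfderiv : fderiv ℝ (fun y => f (c * ‖y - a‖ ^ 2) - b) =
      fun y => (deriv f (c * ‖y - a‖ ^ 2) * (2 * c)) • L (y - a) :=
    funext fun y => ((hasFDerivAt_radial hf₁ a c y).sub_const b).fderiv
  have hsnd := ((hasFDerivAt_radial hf₂ a c x).mul_const (2 * c)).fun_smul
    (L.hasFDerivAt.comp x ((hasFDerivAt_id x).sub_const a))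
  simp only [Function.comp_apply, id_eq] at hsnd
  rw [iteratedFDeriv_two_apply, hfderiv, hsnd.fderiv]
  simp only [Matrix.cons_val_zero, Matrix.cons_val_one, add_apply, smul_apply,
    ContinuousLinearMap.comp_apply, ContinuousLinearMap.id_apply,
    ContinuousLinearMap.smulRight_apply, innerSL_apply_apply, hL, smul_eq_mul,
    real_inner_self_eq_norm_sq]
  ring

/-- With the shape parameter `c = κ/h²`, the Laplacian at the origin of the
shifted radial basis function `ψ_h(x) = f(c‖x − h x̂‖²) − f(c‖h x̂‖²)` equals
`h⁻² A` with `A = 2Dκ f'(κ‖x̂‖²) + 4κ²‖x̂‖² f''(κ‖x̂‖²)` independent of `h`;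
in particular `|Δψ_h(0)| = O(h⁻²)` as `h → 0` with `ch²` held constant. -/
theorem laplacian_shifted_rbf_scaling (D : ℕ) (hD : 1 ≤ D)
    (xhat : EuclideanSpace ℝ (Fin D)) (hxhat : xhat ≠ 0)
    (κ : ℝ) (hκ : 0 < κ) (f : ℝ → ℝ) (hf : ContDiff ℝ 2 f)
    (A : ℝ)
    (hA : A = 2 * D * κ * deriv f (κ * ‖xhat‖ ^ 2) +
        4 * κ ^ 2 * ‖xhat‖ ^ 2 * deriv (deriv f) (κ * ‖xhat‖ ^ 2)) :
    ∀ h : ℝ, 0 < h →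
      ∀ c : ℝ, c = κ / h ^ 2 →
        ∀ ψ : EuclideanSpace ℝ (Fin D) → ℝ,
          ψ = (fun x => f (c * ‖x - h • xhat‖ ^ 2) - f (c * ‖h • xhat‖ ^ 2)) →
            laplacian ψ 0 = h⁻¹ ^ 2 * A := by
  rintro h hh c rfl ψ rfl
  have hnorm : κ / h ^ 2 * ‖(0 : EuclideanSpace ℝ (Fin D)) - h • xhat‖ ^ 2 =
      κ * ‖xhat‖ ^ 2 := by
    rw [zero_sub, norm_neg, norm_smul, mul_pow, Real.norm_eq_abs, sq_abs]
    field_simp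
  have hinner (p : Fin D) : inner ℝ ((0 : EuclideanSpace ℝ (Fin D)) - h • xhat)
      (EuclideanSpace.single p (1 : ℝ)) ^ 2 = h ^ 2 * xhat p ^ 2 := by
    simp [EuclideanSpace.inner_single_right, mul_pow]
  simp only [laplacian, iteratedFDeriv_two_radial_sub_const hf, hnorm, hinner,
    PiLp.norm_single, norm_one, one_pow, mul_one, Finset.sum_add_distrib,
    Finset.sum_const, Finset.card_univ, Fintype.card_fin, nsmul_eq_mul, ← Finset.mul_sum,
    ← EuclideanSpace.real_norm_sq_eq, hA]
  field_simp
  ring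
end

section
/- Let D ≥ 1, k ≥ 2, R > 0, let x₁, …, x_n ∈ EuclideanSpace ℝ (Fin D) satisfy ‖x_i‖ ≤ R for all i, and let w ∈ ℝⁿ be weights such that for every real polynomial p in D variables of total degree at most k, Σ_{i=1}^{n} w_i (p(x_i) − p(0)) = Δp(0). Let u : EuclideanSpace ℝ (Fin D) → ℝ be (k+1)-times continuously differentiable. Then |Σ_{i=1}^{n} w_i (u(x_i) − u(0)) − Δu(0)| ≤ (n/(k+1)!) · (max_i |w_i|) · R^{k+1} · sup_{‖ξ‖ ≤ R} ‖iteratedFDeriv ℝ (k+1) u ξ‖. -/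
/-- Norm estimate for the remainder of Taylor's theorem, in terms of a bound on the `(k + 1)`-st
derivative along the segment from `a` to `a + y`. -/
theorem norm_sub_taylor_sum_le {E F : Type*} [NormedAddCommGroup E] [NormedSpace ℝ E]
    [NormedAddCommGroup F] [NormedSpace ℝ F] [CompleteSpace F] {f : E → F} {k : ℕ}
    (hf : ContDiff ℝ (k + 1) f) (a y : E) {M : ℝ}
    (hM : ∀ t ∈ Set.Icc (0 : ℝ) 1, ‖iteratedFDeriv ℝ (k + 1) f (a + t • y)‖ ≤ M) :
    ‖f (a + y) - ∑ j ∈ Finset.range (k + 1),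
        (Nat.factorial j : ℝ)⁻¹ • iteratedFDeriv ℝ j f a (fun _ => y)‖ ≤
      M * ‖y‖ ^ (k + 1) / Nat.factorial (k + 1) := by
  rw [map_add_eq_sum_add_integral_iteratedFDeriv (n := k) (fun t _ => hf.contDiffAt),
    add_sub_cancel_left, norm_smul, norm_inv, RCLike.norm_natCast]
  have hpow : ∫ t in (0 : ℝ)..1, (1 - t) ^ k = ((k : ℝ) + 1)⁻¹ := by
    have := intervalIntegral.integral_comp_sub_left (fun t : ℝ => t ^ k) (a := 0) (b := 1) 1
    rw [this]
    simp
  have hbound : ‖∫ t in (0 : ℝ)..1,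
      (1 - t) ^ k • iteratedFDeriv ℝ (k + 1) f (a + t • y) (fun _ => y)‖ ≤
      ((k : ℝ) + 1)⁻¹ * (M * ‖y‖ ^ (k + 1)) := by
    rw [← hpow, ← intervalIntegral.integral_mul_const]
    refine intervalIntegral.norm_integral_le_of_norm_le zero_le_one
      (Filter.Eventually.of_forall fun t ht => ?_)
      (Continuous.intervalIntegrable (by fun_prop) _ _)
    have h1 : 0 ≤ (1 - t) ^ k := pow_nonneg (by linarith [ht.2]) _
    rw [norm_smul, Real.norm_of_nonneg h1]
    refine mul_le_mul_of_nonneg_left ?_ h1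
    refine (ContinuousMultilinearMap.le_opNorm _ _).trans ?_
    rw [Finset.prod_const, Finset.card_univ, Fintype.card_fin]
    exact mul_le_mul_of_nonneg_right (hM t ⟨ht.1.le, ht.2⟩) (by positivity)
  refine (mul_le_mul_of_nonneg_left hbound (by positivity)).trans_eq ?_
  rw [Nat.factorial_succ]
  push_cast
  field_simp

/-- A continuous multilinear form, evaluated on the diagonal, is a polynomial function of degree at
most its arity. -/
theorem exists_mvPolynomial_eval_diag {D j : ℕ}
    (A : ContinuousMultilinearMap ℝ (fun _ : Fin j => EuclideanSpace ℝ (Fin D)) ℝ) :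
    ∃ p : MvPolynomial (Fin D) ℝ, p.totalDegree ≤ j ∧
      ∀ y : EuclideanSpace ℝ (Fin D), MvPolynomial.eval (fun q => y q) p = A (fun _ => y) := by
  refine ⟨∑ r : Fin j → Fin D,
    MvPolynomial.C (A fun l => EuclideanSpace.single (r l) (1 : ℝ)) *
      ∏ l, MvPolynomial.X (r l), ?_, fun y => ?_⟩
  · refine MvPolynomial.totalDegree_finsetSum_le fun r _ => ?_
    refine (MvPolynomial.totalDegree_mul _ _).trans ?_
    rw [MvPolynomial.totalDegree_C, zero_add]
    refine (MvPolynomial.totalDegree_finsetProd _ _).trans ?_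
    simp
  · have hy : y = ∑ q, y q • EuclideanSpace.single q (1 : ℝ) := by
      simpa using ((EuclideanSpace.basisFun (Fin D) ℝ).sum_repr y).symm
    conv_rhs => rw [hy]
    rw [A.map_sum fun _ q => y q • EuclideanSpace.single q (1 : ℝ)]
    simp only [map_sum, map_mul, map_prod, MvPolynomial.eval_C, MvPolynomial.eval_X,
      A.map_smul_univ, smul_eq_mul]
    exact Finset.sum_congr rfl fun _ _ => mul_comm _ _

/-- Iterated derivatives of `t ↦ f (t • e)` at the origin. -/
theorem iteratedDeriv_comp_smul_zero {E F : Type*} [NormedAddCommGroup E] [NormedSpace ℝ E]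
    [NormedAddCommGroup F] [NormedSpace ℝ F] {f : E → F} {m : ℕ} (hf : ContDiff ℝ m f) (e : E) :
    iteratedDeriv m (fun t : ℝ => f (t • e)) 0 = iteratedFDeriv ℝ m f 0 (fun _ => e) := by
  have h := (ContinuousLinearMap.toSpanSingleton ℝ e).iteratedFDeriv_comp_right hf 0 le_rfl
  rw [iteratedDeriv_eq_iteratedFDeriv]
  have hfun : (fun t : ℝ => f (t • e)) = f ∘ ContinuousLinearMap.toSpanSingleton ℝ e := by
    ext t; simp
  rw [hfun, h]
  simp

/-- The Laplacian at the origin as a sum of second derivatives along the coordinate axes. -/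
theorem laplacian_zero_eq_sum_iteratedDeriv {D : ℕ} {f : EuclideanSpace ℝ (Fin D) → ℝ}
    (hf : ContDiff ℝ 2 f) :
    laplacian f 0 =
      ∑ p, iteratedDeriv 2 (fun t : ℝ => f (t • EuclideanSpace.single p (1 : ℝ))) 0 := by
  refine Finset.sum_congr rfl fun p _ => ?_
  rw [iteratedDeriv_comp_smul_zero (m := 2) hf]
  congr 1
  ext l
  fin_cases l <;> rfl

/-- The Taylor polynomial of degree `k ≥ 2` at the origin has the same Laplacian there. -/
theorem laplacian_taylor_sum {D k : ℕ} (hk : 2 ≤ k) (u : EuclideanSpace ℝ (Fin D) → ℝ) :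
    laplacian (fun y => ∑ j ∈ Finset.range (k + 1),
      (Nat.factorial j : ℝ)⁻¹ • iteratedFDeriv ℝ j u 0 (fun _ => y)) 0 = laplacian u 0 := by
  have hsmooth : ∀ j, ContDiff ℝ 2 fun y => iteratedFDeriv ℝ j u 0 (fun _ => y) := fun j =>
    (iteratedFDeriv ℝ j u 0).contDiff.comp (contDiff_pi.2 fun _ => contDiff_id)
  rw [laplacian_zero_eq_sum_iteratedDeriv (ContDiff.sum fun j _ => (hsmooth j).const_smul _)]
  refine Finset.sum_congr rfl fun p _ => ?_
  set e := EuclideanSpace.single p (1 : ℝ)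
  set q : Polynomial ℝ := ∑ j ∈ Finset.range (k + 1), Polynomial.monomial j
    ((Nat.factorial j : ℝ)⁻¹ * iteratedFDeriv ℝ j u 0 (fun _ => e)) with hq
  have hfun : (fun t : ℝ => ∑ j ∈ Finset.range (k + 1),
      (Nat.factorial j : ℝ)⁻¹ • iteratedFDeriv ℝ j u 0 (fun _ => t • e)) = fun t => q.eval t := by
    ext t
    rw [hq, Polynomial.eval_finsetSum]
    refine Finset.sum_congr rfl fun j _ => ?_
    rw [ContinuousMultilinearMap.map_smul_univ _ (fun _ => t), Polynomial.eval_monomial]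
    simp
    ring
  have hcoeff : q.coeff 2 = (2 : ℝ)⁻¹ * iteratedFDeriv ℝ 2 u 0 (fun _ => e) := by
    rw [hq, Polynomial.finsetSum_coeff, Finset.sum_eq_single_of_mem 2 (by simp; omega)]
    · simp
    · intro j _ hj
      simp [Polynomial.coeff_monomial, hj]
  have hvec : (![e, e] : Fin 2 → EuclideanSpace ℝ (Fin D)) = fun _ => e := by
    ext l
    fin_cases l <;> rfl
  rw [hfun, iteratedDeriv_succ, iteratedDeriv_one, hvec]
  have hd : ∀ r : Polynomial ℝ, deriv (fun t => r.eval t) = fun t => r.derivative.eval t :=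
    fun r => funext fun t => r.deriv
  rw [hd, hd]
  simp only [← Polynomial.coeff_zero_eq_eval_zero, Polynomial.coeff_derivative]
  rw [hcoeff]
  norm_num
  ring


/-- Taylor-remainder estimate behind Theorem 1: if the weights `w` reproduce
the Laplacian at the origin exactly on all polynomials of total degree at most
`k`, then the error in approximating `Δu(0)` for a `C^{k+1}` function `u` is
bounded by `(n/(k+1)!) (max_i |w_i|) R^{k+1} sup_{‖ξ‖≤R} ‖D^{k+1}u(ξ)‖`. -/
theorem laplacian_weights_taylor_error (D k n : ℕ) (hD : 1 ≤ D) (hk : 2 ≤ k)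
    (R : ℝ) (hR : 0 < R)
    (x : Fin n → EuclideanSpace ℝ (Fin D)) (hx : ∀ i, ‖x i‖ ≤ R)
    (w : Fin n → ℝ)
    (hpoly : ∀ p : MvPolynomial (Fin D) ℝ, p.totalDegree ≤ k →
      ∑ i, w i * (MvPolynomial.eval (fun q => x i q) p -
          MvPolynomial.eval (fun _ => (0 : ℝ)) p) =
        laplacian (fun y => MvPolynomial.eval (fun q => y q) p) 0)
    (u : EuclideanSpace ℝ (Fin D) → ℝ) (hu : ContDiff ℝ (k + 1) u) :
    |∑ i, w i * (u (x i) - u 0) - laplacian u 0| ≤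
      ((n : ℝ) / (Nat.factorial (k + 1))) * (⨆ i, |w i|) * R ^ (k + 1) *
        (⨆ ξ : {ξ : EuclideanSpace ℝ (Fin D) // ‖ξ‖ ≤ R},
          ‖iteratedFDeriv ℝ (k + 1) u ξ‖) := by
  have hbdd : BddAbove (Set.range fun ξ : {ξ : EuclideanSpace ℝ (Fin D) // ‖ξ‖ ≤ R} =>
      ‖iteratedFDeriv ℝ (k + 1) u ξ‖) := by
    have hcont : Continuous fun ξ => ‖iteratedFDeriv ℝ (k + 1) u ξ‖ :=
      (hu.continuous_iteratedFDeriv (m := k + 1) (by norm_cast)).norm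
    refine ((isCompact_closedBall (0 : EuclideanSpace ℝ (Fin D)) R).bddAbove_image
      hcont.continuousOn).mono ?_
    rintro _ ⟨ξ, rfl⟩
    exact ⟨ξ, by simpa using ξ.2, rfl⟩
  set M := ⨆ ξ : {ξ : EuclideanSpace ℝ (Fin D) // ‖ξ‖ ≤ R}, ‖iteratedFDeriv ℝ (k + 1) u ξ‖
  have hM : 0 ≤ M := Real.iSup_nonneg fun _ => norm_nonneg _
  set T : EuclideanSpace ℝ (Fin D) → ℝ := fun y => ∑ j ∈ Finset.range (k + 1),
    (Nat.factorial j : ℝ)⁻¹ • iteratedFDeriv ℝ j u 0 (fun _ => y) with hT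
  have htaylor : ∀ y, ‖y‖ ≤ R → |u y - T y| ≤ M * ‖y‖ ^ (k + 1) / Nat.factorial (k + 1) := by
    intro y hy
    have h := norm_sub_taylor_sum_le hu 0 y (M := M) fun t ht => by
      have hty : ‖t • y‖ ≤ R := by
        rw [norm_smul, Real.norm_of_nonneg ht.1]
        exact (mul_le_of_le_one_left (norm_nonneg _) ht.2).trans hy
      rw [zero_add]
      exact le_ciSup hbdd ⟨t • y, hty⟩
    rwa [zero_add] at h
  have hT0 : T 0 = u 0 := by
    have h := htaylor 0 (by simpa using hR.le)
    rw [norm_zero, zero_pow (Nat.succ_ne_zero k), mul_zero, zero_div] at h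
    exact (sub_eq_zero.mp (abs_nonpos_iff.mp h)).symm
  choose P hPdeg hPeval using fun j =>
    exists_mvPolynomial_eval_diag (iteratedFDeriv ℝ j u 0)
  set p : MvPolynomial (Fin D) ℝ :=
    ∑ j ∈ Finset.range (k + 1), (Nat.factorial j : ℝ)⁻¹ • P j with hp
  have hpdeg : p.totalDegree ≤ k :=
    MvPolynomial.totalDegree_finsetSum_le fun j hj =>
      (MvPolynomial.totalDegree_smul_le _ _).trans
        ((hPdeg j).trans (Nat.lt_succ_iff.mp (Finset.mem_range.mp hj)))
  have hpeval : ∀ y : EuclideanSpace ℝ (Fin D), MvPolynomial.eval (fun q => y q) p = T y := by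
    intro y
    simp only [hp, hT, map_sum, MvPolynomial.smul_eval, hPeval, smul_eq_mul]
  have hexact := hpoly p hpdeg
  have hp0 : MvPolynomial.eval (fun _ => (0 : ℝ)) p = T 0 := hpeval 0
  simp only [hpeval, hp0] at hexact
  rw [hT0, show laplacian (fun y => T y) 0 = laplacian u 0 from laplacian_taylor_sum hk u] at hexact
  rw [← hexact, ← Finset.sum_sub_distrib]
  have hterm : ∀ i, |w i * (u (x i) - u 0) - w i * (T (x i) - u 0)| ≤
      (⨆ i, |w i|) * (M * R ^ (k + 1) / Nat.factorial (k + 1)) := by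
    intro i
    have hwi : |w i| ≤ ⨆ i, |w i| := le_ciSup (Set.finite_range fun i => |w i|).bddAbove i
    have hpow : ‖x i‖ ^ (k + 1) ≤ R ^ (k + 1) := pow_le_pow_left₀ (norm_nonneg _) (hx i) _
    rw [← mul_sub, sub_sub_sub_cancel_right, abs_mul]
    refine mul_le_mul hwi ((htaylor _ (hx i)).trans ?_) (abs_nonneg _)
      ((abs_nonneg _).trans hwi)
    gcongr
  refine (Finset.abs_sum_le_sum_abs _ _).trans ((Finset.sum_le_sum fun i _ => hterm i).trans_eq ?_)
  rw [Finset.sum_const, Finset.card_univ, Fintype.card_fin, nsmul_eq_mul]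
  ring
end

section
/- (Consistency of the CLS-GSP Laplacian, Theorem 1.) Let D ≥ 1 and k ≥ 2, fix points x₁, …, x_n ∈ EuclideanSpace ℝ (Fin D), let u : EuclideanSpace ℝ (Fin D) → ℝ be (k+1)-times continuously differentiable, and let C > 0. Suppose that for each h ∈ (0,1] there are weights w^{(h)} ∈ ℝⁿ such that (i) max_i |w_i^{(h)}| ≤ C·h⁻², and (ii) for every real polynomial p in D variables of total degree at most k, Σ_{i=1}^{n} w_i^{(h)} (p(h·x_i) − p(0)) = Δp(0). Then there exists a constant C' > 0 such that for all h ∈ (0,1], |Σ_{i=1}^{n} w_i^{(h)} (u(h·x_i) − u(0)) − Δu(0)| ≤ C'·h^{k−1}; that is, the approximation of the Laplacian is consistent of order k − 1 as h → 0. -/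
open MvPolynomial in
/-- The homogeneous polynomial `y ↦ A (y, …, y)` of a multilinear form `A`. -/
noncomputable def diagonalPolynomial {D m : ℕ}
    (A : ContinuousMultilinearMap ℝ (fun _ : Fin m => EuclideanSpace ℝ (Fin D)) ℝ) :
    MvPolynomial (Fin D) ℝ :=
  ∑ r : Fin m → Fin D, C (A fun i => EuclideanSpace.single (r i) 1) * ∏ i, X (r i)

theorem eval_diagonalPolynomial {D m : ℕ}
    (A : ContinuousMultilinearMap ℝ (fun _ : Fin m => EuclideanSpace ℝ (Fin D)) ℝ)
    (y : EuclideanSpace ℝ (Fin D)) :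
    MvPolynomial.eval (fun q => y q) (diagonalPolynomial A) = A fun _ => y := by
  have hy : y = ∑ q, y q • EuclideanSpace.single q (1 : ℝ) := by
    ext j
    simp [Pi.single_apply]
  conv_rhs => rw [hy]
  rw [A.map_sum]
  simp [diagonalPolynomial, A.map_smul_univ, mul_comm]

theorem totalDegree_diagonalPolynomial_le {D m : ℕ}
    (A : ContinuousMultilinearMap ℝ (fun _ : Fin m => EuclideanSpace ℝ (Fin D)) ℝ) :
    (diagonalPolynomial A).totalDegree ≤ m := by
  refine MvPolynomial.totalDegree_finsetSum_le fun r _ => ?_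
  refine (MvPolynomial.totalDegree_mul _ _).trans ?_
  rw [MvPolynomial.totalDegree_C, zero_add]
  refine (MvPolynomial.totalDegree_finsetProd _ _).trans ?_
  simp

theorem iteratedDeriv_comp_smul_right {E : Type*} [NormedAddCommGroup E] [NormedSpace ℝ E]
    {f : E → ℝ} {N : WithTop ℕ∞} (hf : ContDiff ℝ N f) {m : ℕ} (hm : (m : WithTop ℕ∞) ≤ N)
    (v : E) (t : ℝ) :
    iteratedDeriv m (fun s : ℝ => f (s • v)) t = iteratedFDeriv ℝ m f (t • v) fun _ => v := by
  have h := (ContinuousLinearMap.toSpanSingleton ℝ v).iteratedFDeriv_comp_right hf t hm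
  have hc : (fun s : ℝ => f (s • v)) = f ∘ ContinuousLinearMap.toSpanSingleton ℝ v := by
    ext s
    simp
  rw [iteratedDeriv_eq_iteratedFDeriv, hc, h]
  simp

/-- The Taylor polynomial of degree `k` of `u` at the origin. -/
noncomputable def mvTaylor {D : ℕ} (k : ℕ) (u : EuclideanSpace ℝ (Fin D) → ℝ) :
    MvPolynomial (Fin D) ℝ :=
  ∑ m ∈ Finset.range (k + 1),
    MvPolynomial.C ((m.factorial : ℝ)⁻¹) * diagonalPolynomial (iteratedFDeriv ℝ m u 0)

theorem totalDegree_mvTaylor_le {D : ℕ} (k : ℕ) (u : EuclideanSpace ℝ (Fin D) → ℝ) :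
    (mvTaylor k u).totalDegree ≤ k := by
  refine MvPolynomial.totalDegree_finsetSum_le fun m hm => ?_
  refine (MvPolynomial.totalDegree_mul _ _).trans ?_
  rw [MvPolynomial.totalDegree_C, zero_add]
  exact (totalDegree_diagonalPolynomial_le _).trans (Finset.mem_range_succ_iff.mp hm)

theorem eval_mvTaylor_smul {D k : ℕ} {u : EuclideanSpace ℝ (Fin D) → ℝ} (hu : ContDiff ℝ k u)
    (v : EuclideanSpace ℝ (Fin D)) (t : ℝ) :
    MvPolynomial.eval (fun q => (t • v) q) (mvTaylor k u) =
      taylorWithinEval (fun s : ℝ => u (s • v)) k Set.univ 0 t := by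
  rw [taylor_within_apply, mvTaylor, map_sum]
  refine Finset.sum_congr rfl fun m hm => ?_
  have hm' : (m : WithTop ℕ∞) ≤ k := by
    exact_mod_cast Finset.mem_range_succ_iff.mp hm
  rw [map_mul, eval_diagonalPolynomial, MvPolynomial.eval_C, iteratedDerivWithin_univ,
    iteratedDeriv_comp_smul_right hu hm', ContinuousMultilinearMap.map_smul_univ]
  simp [mul_assoc]

theorem laplacian_eq_sum_iteratedDeriv {D : ℕ} {u : EuclideanSpace ℝ (Fin D) → ℝ}
    (hu : ContDiff ℝ 2 u) :
    laplacian u 0 = ∑ p : Fin D,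
      iteratedDeriv 2 (fun t : ℝ => u (t • EuclideanSpace.single p (1 : ℝ))) 0 := by
  refine Finset.sum_congr rfl fun p _ => ?_
  rw [iteratedDeriv_comp_smul_right hu le_rfl, zero_smul]
  congr 1
  ext i
  fin_cases i <;> rfl

theorem iteratedDeriv_two_taylorWithinEval {k : ℕ} (hk : 2 ≤ k) (g : ℝ → ℝ) (a : ℝ) :
    iteratedDeriv 2 (taylorWithinEval g k Set.univ a) a = iteratedDeriv 2 g a := by
  obtain ⟨j, rfl⟩ := Nat.exists_eq_add_of_le' hk
  have hd (g : ℝ → ℝ) (n : ℕ) : deriv (taylorWithinEval g (n + 1) Set.univ a) =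
      taylorWithinEval (deriv g) n Set.univ a := by
    ext t
    simpa using (hasDerivAt_taylorWithinEval_succ (x₀ := a) (x := t) (s := Set.univ) g n).deriv
  simp only [iteratedDeriv_succ, iteratedDeriv_zero, hd, taylorWithinEval_self]

theorem contDiff_eval_mvPolynomial {D : ℕ} (p : MvPolynomial (Fin D) ℝ) (N : WithTop ℕ∞) :
    ContDiff ℝ N fun y : EuclideanSpace ℝ (Fin D) => MvPolynomial.eval (fun q => y q) p := by
  simp only [MvPolynomial.eval_eq]
  fun_prop

theorem laplacian_mvTaylor {D k : ℕ} (hk : 2 ≤ k) {u : EuclideanSpace ℝ (Fin D) → ℝ}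
    (hu : ContDiff ℝ k u) :
    laplacian (fun y => MvPolynomial.eval (fun q => y q) (mvTaylor k u)) 0 = laplacian u 0 := by
  rw [laplacian_eq_sum_iteratedDeriv (contDiff_eval_mvPolynomial _ _),
    laplacian_eq_sum_iteratedDeriv (hu.of_le (by exact_mod_cast hk))]
  refine Finset.sum_congr rfl fun p _ => ?_
  simp only [eval_mvTaylor_smul hu]
  exact iteratedDeriv_two_taylorWithinEval hk _ _

theorem exists_abs_sub_eval_mvTaylor_le {D k : ℕ} {u : EuclideanSpace ℝ (Fin D) → ℝ}
    (hu : ContDiff ℝ (k + 1) u) (v : EuclideanSpace ℝ (Fin D)) :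
    ∃ K : ℝ, ∀ h ∈ Set.Icc (0 : ℝ) 1,
      |u (h • v) - MvPolynomial.eval (fun q => (h • v) q) (mvTaylor k u)| ≤ K * h ^ (k + 1) := by
  have hg : ContDiff ℝ (k + 1) fun s : ℝ => u (s • v) := by fun_prop
  obtain ⟨K, hK⟩ := exists_taylor_mean_remainder_bound zero_le_one hg.contDiffOn
  refine ⟨K, fun h hh => ?_⟩
  have hu' : ContDiff ℝ k u := hu.of_le (by exact_mod_cast k.le_succ)
  have hT : taylorWithinEval (fun s : ℝ => u (s • v)) k (Set.Icc 0 1) 0 h =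
      taylorWithinEval (fun s : ℝ => u (s • v)) k Set.univ 0 h := by
    simp only [taylor_within_apply]
    refine Finset.sum_congr rfl fun m hm => ?_
    have hm' : (m : WithTop ℕ∞) ≤ k + 1 := by
      exact_mod_cast (Finset.mem_range.mp hm).le
    rw [iteratedDerivWithin_univ, iteratedDerivWithin_eq_iteratedDeriv
      (uniqueDiffOn_Icc zero_lt_one) (hg.of_le hm').contDiffAt (by simp)]
  rw [eval_mvTaylor_smul hu', ← hT]
  simpa using hK h hh

/-- Theorem 1 (consistency of the CLS-GSP Laplacian): if for each `h ∈ (0,1]`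
the weights `w h` satisfy `max_i |wᵢ| ≤ C h⁻²` and are exact for the Laplacian
at the origin on all polynomials of total degree at most `k` at the shrunk
sample points `h • xᵢ`, then for any `C^{k+1}` function `u` the approximation
`∑ wᵢ (u(h xᵢ) − u(0))` of `Δu(0)` is consistent of order `k − 1`. -/
theorem clsgsp_laplacian_consistency (D k n : ℕ) (hD : 1 ≤ D) (hk : 2 ≤ k)
    (x : Fin n → EuclideanSpace ℝ (Fin D))
    (u : EuclideanSpace ℝ (Fin D) → ℝ) (hu : ContDiff ℝ (k + 1) u)
    (C : ℝ) (hC : 0 < C)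
    (w : ℝ → Fin n → ℝ)
    (hw : ∀ h ∈ Set.Ioc (0 : ℝ) 1, ∀ i, |w h i| ≤ C * (h⁻¹) ^ 2)
    (hpoly : ∀ h ∈ Set.Ioc (0 : ℝ) 1,
      ∀ p : MvPolynomial (Fin D) ℝ, p.totalDegree ≤ k →
        ∑ i, w h i * (MvPolynomial.eval (fun q => (h • x i) q) p -
            MvPolynomial.eval (fun _ => (0 : ℝ)) p) =
          laplacian (fun y => MvPolynomial.eval (fun q => y q) p) 0) :
    ∃ C' : ℝ, 0 < C' ∧ ∀ h ∈ Set.Ioc (0 : ℝ) 1,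
      |∑ i, w h i * (u (h • x i) - u 0) - laplacian u 0| ≤ C' * h ^ (k - 1) := by
  have hu' : ContDiff ℝ k u := hu.of_le (by exact_mod_cast k.le_succ)
  choose K hK using fun i => exists_abs_sub_eval_mvTaylor_le hu (x i)
  refine ⟨∑ i, C * |K i| + 1, by positivity, fun h hh => ?_⟩
  have h0 : 0 < h := hh.1
  have hp0 : MvPolynomial.eval (fun _ => (0 : ℝ)) (mvTaylor k u) = u 0 := by
    simpa using eval_mvTaylor_smul hu' 0 0
  have hexact := hpoly h hh _ (totalDegree_mvTaylor_le k u)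
  rw [laplacian_mvTaylor hk hu', hp0] at hexact
  rw [← hexact, ← Finset.sum_sub_distrib]
  have hterm (i : Fin n) :
      |w h i * (u (h • x i) - u 0) -
          w h i * (MvPolynomial.eval (fun q => (h • x i) q) (mvTaylor k u) - u 0)| ≤
        C * |K i| * h ^ (k - 1) := by
    rw [← mul_sub, sub_sub_sub_cancel_right, abs_mul]
    calc _ ≤ C * h⁻¹ ^ 2 * (|K i| * h ^ (k + 1)) := by
          gcongr
          · exact hw h hh i
          · exact (hK i h ⟨h0.le, hh.2⟩).trans (by gcongr; exact le_abs_self _)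
      _ = C * |K i| * h ^ (k - 1) := by
          rw [show k + 1 = k - 1 + 2 by lia, pow_add]
          field_simp
  calc _ ≤ ∑ i, C * |K i| * h ^ (k - 1) :=
        (Finset.abs_sum_le_sum_abs _ _).trans (Finset.sum_le_sum fun i _ => hterm i)
    _ = (∑ i, C * |K i|) * h ^ (k - 1) := (Finset.sum_mul ..).symm
    _ ≤ _ := by gcongr; simp
end
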